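/- Let 𝔣₁ ⊂ 𝔣 be the linear span of the generators W₁,…,W_r. Then the group (𝔣, ·), where A · B := P(A,B) is the truncated Baker–Campbell–Hausdorff product, is generated by 𝔣₁: every A ∈ 𝔣 can be written as a finite product A₁ · A₂ · ⋯ · A_k with A₁,…,A_k ∈ 𝔣₁. -/

import Mathlib

noncomputable section

open MeasureTheory Set Filter Topology

/-- Right-nested iterated bracket `[V₁,[⋯,[V_{q−1},V_q]⋯]]` of a list of elements of a Lie
ring (the bracket of the empty list is `0`, of a singleton `[X]` is `X`). -/
def nestedBr {L : Type*} [LieRing L] : List L → L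
  | [] => 0
  | [X] => X
  | X :: Y :: l => ⁅X, nestedBr (Y :: l)⁆

/-- The truncated Baker–Campbell–Hausdorff product
`P(A,B) = Σ_{p=1}^s ((−1)^{p+1}/p) Σ_{kᵢ+ℓᵢ≥1, Σ(kᵢ+ℓᵢ)≤s}
  [A^{k₁},B^{ℓ₁},…,A^{k_p},B^{ℓ_p}] / (k₁!⋯k_p!ℓ₁!⋯ℓ_p!(k₁+ℓ₁+⋯+k_p+ℓ_p))`,
where `[⋯]` is the right-nested iterated bracket and `A^k` stands for `k` copies of `A`. -/
def bch {L : Type*} [LieRing L] [LieAlgebra ℝ L] (s : ℕ) (A B : L) : L :=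
  ∑ p ∈ Finset.Icc 1 s, ((-1 : ℝ) ^ (p + 1) / p) •
    ∑ kl : Fin p → Fin (s + 1) × Fin (s + 1),
      if (∀ i, 1 ≤ ((kl i).1 : ℕ) + ((kl i).2 : ℕ)) ∧
          (∑ i, (((kl i).1 : ℕ) + ((kl i).2 : ℕ))) ≤ s then
        (((∏ i, (Nat.factorial ((kl i).1 : ℕ) * Nat.factorial ((kl i).2 : ℕ))) *
            (∑ i, (((kl i).1 : ℕ) + ((kl i).2 : ℕ))) : ℕ) : ℝ)⁻¹ •
          nestedBr ((List.ofFn fun i =>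
            List.replicate ((kl i).1 : ℕ) A ++ List.replicate ((kl i).2 : ℕ) B).flatten)
      else 0

/-- `F`, with distinguished generators `W`, is (a model of) the free nilpotent Lie algebra of
rank `r` and step `s` over `ℝ`: all brackets of more than `s` elements vanish, `F` is spanned by
the iterated brackets of the generators, and it enjoys the universal property with respect to
`ℝ`-Lie algebras that are nilpotent of step at most `s`. -/
def IsFreeNilpotent {F : Type} [LieRing F] [LieAlgebra ℝ F] (r s : ℕ) (W : Fin r → F) : Prop :=
  (∀ l : List F, s < l.length → nestedBr l = 0) ∧
  (Submodule.span ℝ {v : F | ∃ L : List (Fin r), L ≠ [] ∧ v = nestedBr (L.map W)} = ⊤) ∧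
  (∀ (L' : Type) [LieRing L'] [LieAlgebra ℝ L'],
    (∀ l : List L', s < l.length → nestedBr l = 0) →
    ∀ g : Fin r → L', ∃! f : F →ₗ⁅ℝ⁆ L', ∀ i, f (W i) = g i)

/-- A decreasing multiplicative filtration of an algebra which vanishes beyond degree `s`. -/
structure NilpotentFiltration (A : Type*) [Ring A] [Algebra ℝ A] (s : ℕ) where
  /-- The `n`-th term of the filtration. -/
  term : ℕ → Submodule ℝ A
  anti : Antitone term
  one_mem : (1 : A) ∈ term 0
  mul_mem : ∀ {m n : ℕ} {x y : A}, x ∈ term m → y ∈ term n → x * y ∈ term (m + n)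
  eq_bot : term (s + 1) = ⊥

/-- The exponential series truncated after degree `s`. -/
def truncExp {A : Type*} [Ring A] [Algebra ℝ A] (s : ℕ) (x : A) : A :=
  ∑ k ∈ Finset.range (s + 1), ((k.factorial : ℝ)⁻¹) • x ^ k

/-- The logarithm series in `x - 1` truncated after degree `s`. -/
def truncLog {A : Type*} [Ring A] [Algebra ℝ A] (s : ℕ) (x : A) : A :=
  ∑ p ∈ Finset.Icc 1 s, ((-1 : ℝ) ^ (p + 1) / p) • (x - 1) ^ p

section Formal

open Polynomial

theorem X_pow_dvd_truncExp_truncLog (s : ℕ) :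
    (X : ℝ[X]) ^ (s + 1) ∣ truncExp s (truncLog s (1 + X)) - (1 + X) := by
  set l : ℝ[X] := truncLog s (1 + X) with hl
  have hl' : l = ∑ p ∈ Finset.range s, ((-1 : ℝ) ^ p / (p + 1)) • (X : ℝ[X]) ^ (p + 1) := by
    rw [hl, truncLog, Finset.range_eq_Ico]
    refine (Finset.sum_Ico_add' (fun p : ℕ =>
      ((-1 : ℝ) ^ (p + 1) / p) • (1 + X - 1 : ℝ[X]) ^ p) 0 s 1).symm.trans ?_
    refine Finset.sum_congr rfl fun p _ => ?_
    rw [add_sub_cancel_left]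
    push_cast
    congr 2
    ring
  have hXl : X ∣ l := by
    rw [hl']
    exact Finset.dvd_sum fun p _ =>
      (dvd_pow_self X p.succ_ne_zero).trans (dvd_smul_of_dvd _ dvd_rfl)
  have hdl : (1 + X) * derivative l = 1 - (-X) ^ s := by
    have : derivative l = ∑ p ∈ Finset.range s, (-X : ℝ[X]) ^ p := by
      rw [hl', derivative_sum]
      refine Finset.sum_congr rfl fun p _ => ?_
      rw [derivative_smul, derivative_X_pow, neg_pow, smul_eq_C_mul, ← mul_assoc, ← C_mul]
      have : (p + 1 : ℝ) ≠ 0 := by positivity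
      push_cast
      rw [div_mul_cancel₀ _ this]
      simp [neg_pow (X : ℝ[X]) p]
    rw [this, ← mul_neg_geom_sum, sub_neg_eq_add]
  set H : ℝ[X] := truncExp s l with hH
  set H₀ : ℝ[X] := ∑ k ∈ Finset.range s, ((k.factorial : ℝ)⁻¹) • l ^ k with hH₀
  have hHH : H = H₀ + ((s.factorial : ℝ)⁻¹) • l ^ s := by
    rw [hH, truncExp, Finset.sum_range_succ]
  have hdH : derivative H = H₀ * derivative l := by
    rw [hH, truncExp, derivative_sum, Finset.sum_range_succ', hH₀, Finset.sum_mul]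
    simp only [pow_zero, derivative_smul, derivative_one, smul_zero, add_zero]
    refine Finset.sum_congr rfl fun k _ => ?_
    rw [derivative_pow_succ, Nat.factorial_succ, smul_eq_C_mul, smul_eq_C_mul]
    have : (k + 1 : ℝ) ≠ 0 := by positivity
    have h2 : (k.factorial : ℝ) ≠ 0 := by positivity
    rw [← mul_assoc, ← mul_assoc, ← C_mul]
    congr 3
    push_cast
    field_simp
  have hode : X ^ s ∣ (1 + X) * derivative H - H := by
    have h1 : (X : ℝ[X]) ^ s ∣ l ^ s := pow_dvd_pow_of_dvd hXl s
    have h2 : (X : ℝ[X]) ^ s ∣ (-X) ^ s := pow_dvd_pow_of_dvd (by simp) s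
    have : (1 + X) * derivative H - H
        = -(H₀ * (-X) ^ s) - ((s.factorial : ℝ)⁻¹) • l ^ s := by
      rw [hdH, mul_left_comm, hdl, hHH]; ring
    rw [this]
    exact dvd_sub ((h2.mul_left _).neg_right) (dvd_smul_of_dvd _ h1)
  have hrec : ∀ n < s, H.coeff (n + 1) * (n + 1) = (1 - n) * H.coeff n := by
    intro n hn
    have h := X_pow_dvd_iff.1 hode n hn
    rw [add_mul, one_mul, coeff_sub, coeff_add, coeff_derivative] at h
    cases n with
    | zero => simp at h ⊢; linarith
    | succ n =>
      rw [coeff_X_mul, coeff_derivative] at h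
      push_cast at h ⊢
      linarith
  have h0 : H.coeff 0 = 1 := by
    have : l.coeff 0 = 0 := X_dvd_iff.1 hXl
    rw [hH, truncExp, finsetSum_coeff, Finset.sum_range_succ']
    simp only [pow_zero, coeff_zero_eq_eval_zero] at this ⊢
    simp [this]
  have hge : ∀ n, n + 2 ≤ s → H.coeff (n + 2) = 0 := by
    intro n
    induction n with
    | zero =>
      intro h
      have := hrec 1 (by omega)
      norm_num at this
      exact this
    | succ n ih =>
      intro h
      have := hrec (n + 2) (by omega)
      rw [ih (by omega), mul_zero] at this
      exact (mul_eq_zero.1 this).resolve_right (by positivity)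
  rw [X_pow_dvd_iff]
  intro n hn
  rw [coeff_sub, coeff_add, coeff_one, coeff_X]
  match n, hn with
  | 0, _ => simp [h0]
  | 1, hn =>
    have := hrec 0 (by omega)
    simp [h0] at this
    simp [this]
  | n + 2, hn => simp [hge n (by omega)]

end Formal

section Filtration

variable {A : Type*} [Ring A] [Algebra ℝ A] {s : ℕ}

namespace NilpotentFiltration

variable (T : NilpotentFiltration A s)

theorem eq_zero {n : ℕ} {x : A} (hx : x ∈ T.term n) (hn : s < n) : x = 0 := by
  have := T.anti (Nat.succ_le_of_lt hn) hx
  rwa [Nat.succ_eq_add_one, T.eq_bot, Submodule.mem_bot] at this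

theorem pow_mem {n : ℕ} {x : A} (hx : x ∈ T.term n) (k : ℕ) : x ^ k ∈ T.term (k * n) := by
  induction k with
  | zero => simpa using T.one_mem
  | succ k ih => rw [pow_succ, Nat.succ_mul]; exact T.mul_mem ih hx

theorem pow_eq_zero {x : A} (hx : x ∈ T.term 1) {k : ℕ} (hk : s < k) : x ^ k = 0 :=
  T.eq_zero (T.pow_mem hx k) (by omega)

theorem mul_mem_of_le {m n k : ℕ} {x y : A} (hx : x ∈ T.term m) (hy : y ∈ T.term n)
    (h : k ≤ m + n) : x * y ∈ T.term k :=
  T.anti h (T.mul_mem hx hy)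

end NilpotentFiltration

theorem truncExp_zero : truncExp s (0 : A) = 1 := by
  rw [truncExp, Finset.sum_range_succ']
  simp

theorem truncExp_eq_one_add (x : A) : truncExp s x =
    1 + ∑ k ∈ Finset.range s, (((k + 1).factorial : ℝ)⁻¹) • x ^ (k + 1) := by
  rw [truncExp, Finset.sum_range_succ', add_comm]
  simp

namespace NilpotentFiltration

variable (T : NilpotentFiltration A s)

theorem truncExp_sub_sub_mem {n : ℕ} {x : A} (hn : 1 ≤ n) (hx : x ∈ T.term n) :
    truncExp s x - 1 - x ∈ T.term (2 * n) := by
  cases s with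
  | zero =>
    have : x = 0 := T.eq_zero hx hn
    simp [this, truncExp_zero]
  | succ t =>
    rw [truncExp_eq_one_add, Finset.sum_range_succ']
    have : (1 + (∑ k ∈ Finset.range t, (((k + 1 + 1).factorial : ℝ)⁻¹) • x ^ (k + 1 + 1) +
        (((0 + 1).factorial : ℝ)⁻¹) • x ^ (0 + 1)) - 1 - x) =
        ∑ k ∈ Finset.range t, (((k + 1 + 1).factorial : ℝ)⁻¹) • x ^ (k + 1 + 1) := by
      simp
    rw [this]
    refine Submodule.sum_mem _ fun k _ => Submodule.smul_mem _ _ ?_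
    exact T.anti (Nat.mul_le_mul_right n (by omega)) (T.pow_mem hx _)

theorem truncExp_sub_one_mem {n : ℕ} {x : A} (hn : 1 ≤ n) (hx : x ∈ T.term n) :
    truncExp s x - 1 ∈ T.term n := by
  have h := Submodule.add_mem _ (T.anti (by omega) (T.truncExp_sub_sub_mem hn hx)) hx
  rwa [sub_add_cancel] at h

theorem add_pow_sub_mem {n : ℕ} {x w : A} (hn : 1 ≤ n) (hx : x ∈ T.term 1)
    (hw : w ∈ T.term n) (k : ℕ) : (x + w) ^ (k + 1) - x ^ (k + 1) ∈ T.term (n + k) := by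
  induction k with
  | zero => simpa using hw
  | succ k ih =>
    have : (x + w) ^ (k + 1 + 1) - x ^ (k + 1 + 1) =
        ((x + w) ^ (k + 1) - x ^ (k + 1)) * (x + w) + x ^ (k + 1) * w := by
      rw [pow_succ (x + w), pow_succ x]; noncomm_ring
    rw [this]
    refine Submodule.add_mem _ ?_ ?_
    · exact T.mul_mem_of_le ih (Submodule.add_mem _ hx (T.anti hn hw)) (by omega)
    · exact T.mul_mem_of_le (T.pow_mem hx (k + 1)) hw (by omega)

theorem truncExp_add_sub_mem {n : ℕ} {x w : A} (hn : 1 ≤ n) (hx : x ∈ T.term 1)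
    (hw : w ∈ T.term n) : truncExp s (x + w) - truncExp s x - w ∈ T.term (n + 1) := by
  cases s with
  | zero =>
    have : w = 0 := T.eq_zero hw hn
    simp [this]
  | succ t =>
    rw [truncExp_eq_one_add, truncExp_eq_one_add, Finset.sum_range_succ', Finset.sum_range_succ']
    have : ∀ P Q : A, 1 + (P + (((0 + 1).factorial : ℝ)⁻¹) • (x + w) ^ (0 + 1)) -
        (1 + (Q + (((0 + 1).factorial : ℝ)⁻¹) • x ^ (0 + 1))) - w = P - Q := by
      intro P Q
      simp only [zero_add, Nat.factorial_one, Nat.cast_one, inv_one, pow_one, one_smul]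
      abel
    rw [this, ← Finset.sum_sub_distrib]
    refine Submodule.sum_mem _ fun k _ => ?_
    rw [← smul_sub]
    exact Submodule.smul_mem _ _ (T.anti (by omega) (T.add_pow_sub_mem hn hx hw (k + 1)))

end NilpotentFiltration

theorem truncExp_eq_isNilpotent_exp [Module ℚ A] {x : A} (hx : x ^ (s + 1) = 0) :
    truncExp s x = IsNilpotent.exp x := by
  rw [IsNilpotent.exp_eq_sum hx, truncExp]
  refine Finset.sum_congr rfl fun k _ => ?_
  rw [← Rat.cast_smul_eq_qsmul ℝ]
  simp

theorem truncExp_mul_truncExp_neg {x : A} (hx : x ^ (s + 1) = 0) :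
    truncExp s x * truncExp s (-x) = 1 := by
  let _ : Module ℚ A := Module.compHom A (algebraMap ℚ ℝ)
  rw [truncExp_eq_isNilpotent_exp hx, truncExp_eq_isNilpotent_exp (by rw [neg_pow, hx, mul_zero])]
  exact IsNilpotent.exp_mul_exp_neg_self ⟨_, hx⟩

theorem truncExp_neg_mul_truncExp {x : A} (hx : x ^ (s + 1) = 0) :
    truncExp s (-x) * truncExp s x = 1 := by
  simpa using truncExp_mul_truncExp_neg (s := s) (x := -x) (by rw [neg_pow, hx, mul_zero])

/-- Conjugation by the exponential of `z` preserves modulo `N` the elements whose commutator with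
`z` lies in a submodule `N` stable under commutators with `z`. -/
theorem conj_truncExp_sub_mem {z y : A} (hz : z ^ (s + 1) = 0) (N : Submodule ℝ A)
    (hy : y * z - z * y ∈ N) (hN : ∀ x ∈ N, x * z - z * x ∈ N) :
    truncExp s (-z) * y * truncExp s z - y ∈ N := by
  let _ : Module ℚ A := Module.compHom A (algebraMap ℚ ℝ)
  let _ : Module ℚ (Module.End ℝ A) := Module.compHom _ (algebraMap ℚ ℝ)
  set R : Module.End ℝ A := LinearMap.mulRight ℝ z
  set L : Module.End ℝ A := LinearMap.mulLeft ℝ (-z)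
  have hR : R ^ (s + 1) = 0 := by rw [LinearMap.pow_mulRight, hz]; simp
  have hL : L ^ (s + 1) = 0 := by rw [LinearMap.pow_mulLeft, neg_pow, hz]; simp
  have hc : Commute L R := LinearMap.commute_mulLeft_right (-z) z
  have hsum : (L + R) ^ (2 * s + 1) = 0 :=
    hc.add_pow_eq_zero_of_add_le_succ_of_pow_eq_zero hL hR (by omega)
  have happ : ∀ x, (L + R) x = x * z - z * x := fun x => by simp [L, R, neg_add_eq_sub]
  have h1 : truncExp (2 * s) (L + R) = truncExp s L * truncExp s R := by
    rw [truncExp_eq_isNilpotent_exp hsum, truncExp_eq_isNilpotent_exp hR,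
      truncExp_eq_isNilpotent_exp hL, IsNilpotent.exp_add_of_commute hc ⟨_, hL⟩ ⟨_, hR⟩]
  have h2 : truncExp s (-z) * y * truncExp s z = truncExp (2 * s) (L + R) y := by
    rw [h1, Module.End.mul_apply]
    simp only [truncExp, LinearMap.sum_apply, LinearMap.smul_apply, R, L,
      LinearMap.pow_mulRight, LinearMap.pow_mulLeft, LinearMap.mulRight_apply,
      LinearMap.mulLeft_apply, map_sum, map_smul, Finset.sum_mul, Finset.mul_sum, smul_mul_assoc,
      mul_smul_comm, mul_assoc, Finset.smul_sum]
  rw [h2, truncExp_eq_one_add, LinearMap.add_apply, Module.End.one_apply, add_sub_cancel_left,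
    LinearMap.sum_apply]
  refine Submodule.sum_mem _ fun k hk => Submodule.smul_mem _ _ ?_
  clear hk
  induction k with
  | zero => rwa [zero_add, pow_one, happ]
  | succ k ih => rw [pow_succ', Module.End.mul_apply, happ]; exact hN _ ih

theorem NilpotentFiltration.truncLog_mem (T : NilpotentFiltration A s) {g : A}
    (hg : g - 1 ∈ T.term 1) : truncLog s g ∈ T.term 1 := by
  refine Submodule.sum_mem _ fun p hp => Submodule.smul_mem _ _ ?_
  exact T.anti (by simpa using (Finset.mem_Icc.1 hp).1) (T.pow_mem hg p)

theorem map_truncExp {B : Type*} [Ring B] [Algebra ℝ B] (f : A →ₐ[ℝ] B) (x : A) :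
    f (truncExp s x) = truncExp s (f x) := by
  simp [truncExp, map_sum]

theorem map_truncLog {B : Type*} [Ring B] [Algebra ℝ B] (f : A →ₐ[ℝ] B) (x : A) :
    f (truncLog s x) = truncLog s (f x) := by
  simp [truncLog, map_sum]

theorem truncExp_truncLog {g : A} (hg : (g - 1) ^ (s + 1) = 0) :
    truncExp s (truncLog s g) = g := by
  obtain ⟨q, hq⟩ := X_pow_dvd_truncExp_truncLog s
  have h := congrArg (Polynomial.aeval (g - 1)) hq
  rw [map_sub, map_truncExp, map_truncLog] at h
  simpa [hg, sub_eq_zero] using h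

/-- If `Y` acts on each graded piece of the filtration as the degree, and `L` is a `Y`-stable Lie
subalgebra, then `L` is stable under the Baker-Campbell-Hausdorff product. -/
theorem NilpotentFiltration.mem_of_truncExp_eq_mul (T : NilpotentFiltration A s) (Y : A)
    (hY : ∀ n, ∀ w ∈ T.term n, Y * w - w * Y - (n : ℝ) • w ∈ T.term (n + 1))
    (L : Submodule ℝ A) (hLT : L ≤ T.term 1) (hLL : ∀ x ∈ L, ∀ y ∈ L, x * y - y * x ∈ L)
    (hYL : ∀ x ∈ L, Y * x - x * Y ∈ L) {a b Z : A} (ha : a ∈ L) (hb : b ∈ L)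
    (hZ : Z ∈ T.term 1) (hexp : truncExp s Z = truncExp s a * truncExp s b) : Z ∈ L := by
  have hpow : ∀ x ∈ L, x ^ (s + 1) = 0 := fun x hx => T.pow_eq_zero (hLT hx) (Nat.lt_succ_self s)
  have hconj : ∀ x ∈ L, ∀ y ∈ L, truncExp s (-x) * y * truncExp s x ∈ L := fun x hx y hy => by
    have := conj_truncExp_sub_mem (hpow x hx) L (hLL y hy x hx) fun u hu => hLL u hu x hx
    simpa using L.add_mem this hy
  have hconjY : ∀ x ∈ L, truncExp s (-x) * Y * truncExp s x - Y ∈ L := fun x hx =>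
    conj_truncExp_sub_mem (hpow x hx) L (hYL x hx) fun u hu => hLL u hu x hx
  have key : ∀ n, 1 ≤ n → ∃ z ∈ L, Z - z ∈ T.term n := by
    intro n hn
    induction n, hn using Nat.le_induction with
    | base => exact ⟨0, L.zero_mem, by simpa using hZ⟩
    | succ n hn ih =>
      obtain ⟨z, hz, hw⟩ := ih
      set w := Z - z with hwdef
      set M := truncExp s (-z) * truncExp s a * truncExp s b with hM
      set M' := truncExp s (-b) * truncExp s (-a) * truncExp s z with hM'
      have hM'M : M' * M = 1 := by
        calc M' * M = truncExp s (-b) * (truncExp s (-a) *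
              (truncExp s z * truncExp s (-z)) * truncExp s a) * truncExp s b := by
              rw [hM, hM']; simp only [mul_assoc]
          _ = 1 := by
              rw [truncExp_mul_truncExp_neg (hpow z hz), mul_one,
                truncExp_neg_mul_truncExp (hpow a ha), mul_one,
                truncExp_neg_mul_truncExp (hpow b hb)]
      have hMT : M - 1 - w ∈ T.term (n + 1) := by
        have h1 := T.truncExp_add_sub_mem hn (hLT hz) hw
        rw [hwdef, add_sub_cancel, ← hwdef, hexp] at h1
        have h2 : truncExp s (-z) - 1 ∈ T.term 1 :=
          T.truncExp_sub_one_mem le_rfl (Submodule.neg_mem _ (hLT hz))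
        have h3 : M - 1 - w = (truncExp s (-z) - 1) *
            (truncExp s a * truncExp s b - truncExp s z - w) +
            (truncExp s a * truncExp s b - truncExp s z - w) + (truncExp s (-z) - 1) * w := by
          have h4 := truncExp_neg_mul_truncExp (hpow z hz)
          rw [hM, mul_assoc]
          generalize truncExp s (-z) = e at h4 ⊢
          generalize truncExp s a * truncExp s b = g
          generalize truncExp s z = f at h4 ⊢
          simp only [sub_mul, mul_sub, h4, one_mul]
          abel
        rw [h3]
        refine Submodule.add_mem _ (Submodule.add_mem _ ?_ h1) ?_
        · exact T.mul_mem_of_le h2 h1 (by omega)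
        · exact T.mul_mem_of_le h2 hw (by omega)
      have hM'T : M' - 1 ∈ T.term 1 := by
        have hneg : ∀ x ∈ L, truncExp s (-x) - 1 ∈ T.term 1 := fun x hx =>
          T.truncExp_sub_one_mem le_rfl (Submodule.neg_mem _ (hLT hx))
        have hz' := T.truncExp_sub_one_mem le_rfl (hLT hz)
        have hmul : ∀ {x y : A}, x - 1 ∈ T.term 1 → y - 1 ∈ T.term 1 → x * y - 1 ∈ T.term 1 := by
          intro x y hx hy
          have : x * y - 1 = (x - 1) * (y - 1) + (x - 1) + (y - 1) := by noncomm_ring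
          rw [this]
          exact Submodule.add_mem _ (Submodule.add_mem _ (T.mul_mem_of_le hx hy (by omega)) hx) hy
        exact hmul (hmul (hneg b hb) (hneg a ha)) hz'
      have hl : M' * Y * M - Y ∈ L := by
        have h1 : truncExp s z * Y * truncExp s (-z) - Y ∈ L := by
          simpa using hconjY (-z) (L.neg_mem hz)
        have h2 := L.add_mem (hconj a ha _ h1) (hconjY a ha)
        have h3 := L.add_mem (hconj b hb _ h2) (hconjY b hb)
        convert h3 using 1
        rw [hM, hM']
        noncomm_ring
      have hYM : Y * M - M * Y - (n : ℝ) • w ∈ T.term (n + 1) := by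
        set t := M - 1 - w with ht
        have h1 := Submodule.add_mem _ (T.anti (Nat.le_succ (n + 1)) (hY (n + 1) t hMT))
          (Submodule.smul_mem _ ((n + 1 : ℕ) : ℝ) hMT)
        rw [sub_add_cancel] at h1
        have h2 : Y * M - M * Y - (n : ℝ) • w =
            (Y * w - w * Y - (n : ℝ) • w) + (Y * t - t * Y) := by
          have : M = 1 + w + t := by rw [ht]; abel
          rw [this, mul_add, mul_add, add_mul, add_mul, mul_one, one_mul]
          abel
        rw [h2]
        exact Submodule.add_mem _ (hY n w hw) h1
      have hYM' : Y * M - M * Y ∈ T.term n := by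
        have := Submodule.add_mem _ (T.anti (Nat.le_succ n) hYM)
          (Submodule.smul_mem _ (n : ℝ) hw)
        rwa [sub_add_cancel] at this
      have hfin : (n : ℝ) • w - (M' * Y * M - Y) ∈ T.term (n + 1) := by
        have h1 : (n : ℝ) • w - (M' * Y * M - Y) =
            -((M' - 1) * (Y * M - M * Y)) - (Y * M - M * Y - (n : ℝ) • w) := by
          have : M' * (Y * M - M * Y) = M' * Y * M - Y := by
            rw [mul_sub, ← mul_assoc M' Y, ← mul_assoc M' M, hM'M, one_mul]
          rw [sub_mul, this, one_mul]
          abel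
        rw [h1]
        exact Submodule.sub_mem _ (Submodule.neg_mem _ (T.mul_mem_of_le hM'T hYM' (by omega))) hYM
      have hn0 : (n : ℝ) ≠ 0 := by positivity
      refine ⟨z + (n : ℝ)⁻¹ • (M' * Y * M - Y), L.add_mem hz (L.smul_mem _ hl), ?_⟩
      have := Submodule.smul_mem _ (n : ℝ)⁻¹ hfin
      rwa [smul_sub, inv_smul_smul₀ hn0, hwdef, sub_sub] at this
  obtain ⟨z, hz, h⟩ := key (s + 1) (by omega)
  rw [T.eq_bot, Submodule.mem_bot, sub_eq_zero] at h
  exact h ▸ hz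

end Filtration

section BracketSpan

variable {K : Type*} [LieRing K] {ι : Type*}

theorem nestedBr_cons (x : K) {l : List K} (hl : l ≠ []) : nestedBr (x :: l) = ⁅x, nestedBr l⁆ := by
  cases l with
  | nil => exact absurd rfl hl
  | cons y l => rfl

variable [LieAlgebra ℝ K]

/-- The span of the right-nested brackets of at least `n` members of the family `g`. -/
def bracketSpan (g : ι → K) (n : ℕ) : Submodule ℝ K :=
  Submodule.span ℝ {v | ∃ l : List ι, n ≤ l.length ∧ v = nestedBr (l.map g)}

variable (g : ι → K)

theorem nestedBr_mem_bracketSpan {n : ℕ} (l : List ι) (h : n ≤ l.length) :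
    nestedBr (l.map g) ∈ bracketSpan g n :=
  Submodule.subset_span ⟨l, h, rfl⟩

theorem bracketSpan_anti : Antitone (bracketSpan g) := fun _ _ h =>
  Submodule.span_mono fun _ ⟨l, hl, hv⟩ => ⟨l, h.trans hl, hv⟩

theorem lie_apply_mem_bracketSpan {n : ℕ} (i : ι) {x : K} (hx : x ∈ bracketSpan g n) :
    ⁅g i, x⁆ ∈ bracketSpan g (n + 1) := by
  induction hx using Submodule.span_induction with
  | mem x h =>
    obtain ⟨l, hl, rfl⟩ := h
    rcases eq_or_ne l [] with rfl | hne
    · simp [nestedBr]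
    · rw [← nestedBr_cons _ (by simpa using hne)]
      exact nestedBr_mem_bracketSpan g (i :: l) (by simpa using hl)
  | zero => simp
  | add x y _ _ hx hy => rw [lie_add]; exact Submodule.add_mem _ hx hy
  | smul c x _ hx => rw [lie_smul]; exact Submodule.smul_mem _ _ hx

theorem nestedBr_lie_mem_bracketSpan {n : ℕ} (l : List ι) {x : K} (hx : x ∈ bracketSpan g n) :
    ⁅nestedBr (l.map g), x⁆ ∈ bracketSpan g (l.length + n) := by
  induction l generalizing n x with
  | nil => simp [nestedBr]
  | cons i l ih =>
    rcases eq_or_ne l [] with rfl | hne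
    · simpa [nestedBr, add_comm] using lie_apply_mem_bracketSpan g i hx
    · rw [List.map_cons, nestedBr_cons _ (by simpa using hne), lie_lie]
      have h1 := lie_apply_mem_bracketSpan g i (ih hx)
      have h2 := ih (lie_apply_mem_bracketSpan g i hx)
      rw [List.length_cons]
      exact Submodule.sub_mem _ (bracketSpan_anti g (by omega) h1)
        (bracketSpan_anti g (by omega) h2)

theorem lie_mem_bracketSpan {m n : ℕ} {x y : K} (hx : x ∈ bracketSpan g m)
    (hy : y ∈ bracketSpan g n) : ⁅x, y⁆ ∈ bracketSpan g (m + n) := by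
  induction hx using Submodule.span_induction with
  | mem x h =>
    obtain ⟨l, hl, rfl⟩ := h
    exact bracketSpan_anti g (by omega) (nestedBr_lie_mem_bracketSpan g l hy)
  | zero => simp
  | add x y _ _ hx hy => rw [add_lie]; exact Submodule.add_mem _ hx hy
  | smul c x _ hx => rw [smul_lie]; exact Submodule.smul_mem _ _ hx

end BracketSpan

/-- The filtration of the endomorphism algebra induced by a filtration of the module. -/
def endFiltration {V : Type*} [AddCommGroup V] [Module ℝ V] {s : ℕ} (U : ℕ → Submodule ℝ V)
    (hU : Antitone U) (h0 : U 0 = ⊤) (hs : U (s + 1) = ⊥) :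
    NilpotentFiltration (Module.End ℝ V) s where
  term n :=
    { carrier := {f | ∀ j, ∀ v ∈ U j, f v ∈ U (j + n)}
      add_mem' := fun hf hg j v hv => Submodule.add_mem _ (hf j v hv) (hg j v hv)
      zero_mem' := fun _ _ _ => Submodule.zero_mem _
      smul_mem' := fun c _ hf j v hv => Submodule.smul_mem _ c (hf j v hv) }
  anti := fun _ _ h _ hf j v hv => hU (Nat.add_le_add_left h j) (hf j v hv)
  one_mem := fun _ _ hv => hv
  mul_mem := fun {m n f g} hf hg j v hv => by
    have := hf _ _ (hg j v hv)
    rwa [add_assoc, add_comm n m] at this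
  eq_bot := by
    rw [eq_bot_iff]
    intro f hf
    refine (Submodule.mem_bot ℝ).2 (LinearMap.ext fun v => ?_)
    have := hf 0 v (by rw [h0]; trivial)
    rwa [zero_add, hs, Submodule.mem_bot] at this

section Associative

attribute [local instance] LieRing.ofAssociativeRing

section Commutator

variable {A : Type*} [Ring A]

theorem nestedBr_cons_eq_sub (x : A) {l : List A} (hl : l ≠ []) :
    nestedBr (x :: l) = x * nestedBr l - nestedBr l * x := by
  rw [nestedBr_cons x hl, LieRing.of_associative_ring_bracket]

variable [Algebra ℝ A] {ι : Type*} (g : ι → A)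

theorem NilpotentFiltration.nestedBr_mem {s : ℕ} (T : NilpotentFiltration A s)
    (hg : ∀ i, g i ∈ T.term 1) (l : List ι) : nestedBr (l.map g) ∈ T.term 1 := by
  induction l with
  | nil => exact Submodule.zero_mem _
  | cons i l ih =>
    rcases eq_or_ne l [] with rfl | hne
    · exact hg i
    · rw [List.map_cons, nestedBr_cons_eq_sub _ (by simpa using hne)]
      exact Submodule.sub_mem _ (T.mul_mem_of_le (hg i) ih (Nat.le_add_left 1 1))
        (T.mul_mem_of_le ih (hg i) (Nat.le_add_left 1 1))

theorem commutator_nestedBr {Y : A} (hY : ∀ i, Y * g i - g i * Y = g i) (l : List ι) :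
    Y * nestedBr (l.map g) - nestedBr (l.map g) * Y = (l.length : ℝ) • nestedBr (l.map g) := by
  induction l with
  | nil => simp [nestedBr]
  | cons i l ih =>
    rcases eq_or_ne l [] with rfl | hne
    · simpa [nestedBr] using hY i
    · rw [List.map_cons, nestedBr_cons_eq_sub _ (by simpa using hne)]
      set x := nestedBr (l.map g)
      have h : Y * (g i * x - x * g i) - (g i * x - x * g i) * Y =
          ((Y * g i - g i * Y) * x - x * (Y * g i - g i * Y)) +
            (g i * (Y * x - x * Y) - (Y * x - x * Y) * g i) := by
        noncomm_ring
      rw [h, hY, ih, mul_smul_comm, smul_mul_assoc, List.length_cons]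
      push_cast
      module

theorem commutator_mem_bracketSpan {x y : A} (hx : x ∈ bracketSpan g 0)
    (hy : y ∈ bracketSpan g 0) : x * y - y * x ∈ bracketSpan g 0 := by
  have := lie_mem_bracketSpan g hx hy
  rwa [LieRing.of_associative_ring_bracket] at this

theorem degree_commutator_mem_bracketSpan {Y : A} (hY : ∀ i, Y * g i - g i * Y = g i) {x : A}
    (hx : x ∈ bracketSpan g 0) : Y * x - x * Y ∈ bracketSpan g 0 := by
  induction hx using Submodule.span_induction with
  | mem x h =>
    obtain ⟨l, -, rfl⟩ := h
    rw [commutator_nestedBr g hY]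
    exact Submodule.smul_mem _ _ (nestedBr_mem_bracketSpan g l (Nat.zero_le _))
  | zero => simp
  | add x y _ _ hx hy =>
    rw [mul_add, add_mul, add_sub_add_comm]; exact Submodule.add_mem _ hx hy
  | smul c x _ hx =>
    rw [mul_smul_comm, smul_mul_assoc, ← smul_sub]; exact Submodule.smul_mem _ _ hx

end Commutator

section Words

variable {s : ℕ}

variable (s) in
/-- The truncated free associative algebra on two letters, as a vector space with the words of
length at most `s` as a basis. -/
abbrev WordSpace := {w : List Bool // w.length ≤ s} →₀ ℝ

variable (s) in
/-- The image of a word in the truncated free algebra. -/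
def wordVec (w : List Bool) : WordSpace s :=
  if h : w.length ≤ s then Finsupp.single ⟨w, h⟩ 1 else 0

theorem wordVec_eq_zero {w : List Bool} (h : s < w.length) : wordVec s w = 0 :=
  dif_neg (not_le.2 h)

section Lift

variable {M : Type*} [AddCommGroup M] [Module ℝ M]

/-- The linear map with prescribed values on words. -/
def wordLift (φ : List Bool → M) : WordSpace s →ₗ[ℝ] M :=
  Finsupp.linearCombination ℝ fun w => φ w.1

theorem wordLift_wordVec (φ : List Bool → M) (w : List Bool) :
    wordLift φ (wordVec s w) = if w.length ≤ s then φ w else 0 := by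
  by_cases h : w.length ≤ s <;> simp [wordLift, wordVec, h]

theorem wordSpace_hom_ext {f g : WordSpace s →ₗ[ℝ] M}
    (h : ∀ w, w.length ≤ s → f (wordVec s w) = g (wordVec s w)) : f = g := by
  refine Finsupp.lhom_ext' fun w => LinearMap.ext_ring ?_
  simpa [wordVec, w.2] using h w.1 w.2

end Lift

variable (s) in
/-- Left multiplication by a letter. -/
def letterOp (i : Bool) : Module.End ℝ (WordSpace s) :=
  wordLift fun w => wordVec s (i :: w)

theorem letterOp_wordVec (i : Bool) (w : List Bool) :
    letterOp s i (wordVec s w) = wordVec s (i :: w) := by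
  rw [letterOp, wordLift_wordVec]
  split_ifs with h
  · rfl
  · rw [wordVec_eq_zero (by rw [List.length_cons]; omega)]

variable (s) in
/-- The derivation multiplying a word by its length. -/
def wordDegree : Module.End ℝ (WordSpace s) :=
  wordLift fun w => (w.length : ℝ) • wordVec s w

theorem wordDegree_wordVec (w : List Bool) :
    wordDegree s (wordVec s w) = (w.length : ℝ) • wordVec s w := by
  rw [wordDegree, wordLift_wordVec]
  split_ifs with h
  · rfl
  · rw [wordVec_eq_zero (by omega), smul_zero]

variable (s) in
/-- The span of the words of length at least `n`. -/
def wordFilt (n : ℕ) : Submodule ℝ (WordSpace s) :=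
  Submodule.span ℝ {v | ∃ w : List Bool, n ≤ w.length ∧ v = wordVec s w}

theorem wordVec_mem_wordFilt {n : ℕ} {w : List Bool} (h : n ≤ w.length) :
    wordVec s w ∈ wordFilt s n :=
  Submodule.subset_span ⟨w, h, rfl⟩

theorem wordFilt_anti : Antitone (wordFilt s) := fun _ _ h =>
  Submodule.span_mono fun _ ⟨w, hw, hv⟩ => ⟨w, h.trans hw, hv⟩

theorem wordFilt_zero : wordFilt s 0 = ⊤ := by
  refine eq_top_iff.2 fun v _ => ?_
  induction v using Finsupp.induction_linear with
  | zero => exact Submodule.zero_mem _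
  | add x y hx hy => exact Submodule.add_mem _ (hx trivial) (hy trivial)
  | single w c =>
    have : Finsupp.single w c = c • wordVec s w.1 := by simp [wordVec, w.2]
    rw [this]
    exact Submodule.smul_mem _ _ (wordVec_mem_wordFilt (Nat.zero_le _))

theorem wordFilt_succ : wordFilt s (s + 1) = ⊥ := by
  rw [eq_bot_iff, wordFilt, Submodule.span_le]
  rintro _ ⟨w, hw, rfl⟩
  exact wordVec_eq_zero hw

variable (s) in
/-- The degree filtration on the endomorphisms of the truncated free algebra. -/
def wordEndFilt : NilpotentFiltration (Module.End ℝ (WordSpace s)) s :=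
  endFiltration (wordFilt s) wordFilt_anti wordFilt_zero wordFilt_succ

theorem letterOp_mem (i : Bool) : letterOp s i ∈ (wordEndFilt s).term 1 := by
  intro j v hv
  induction hv using Submodule.span_induction with
  | mem x h =>
    obtain ⟨w, hw, rfl⟩ := h
    rw [letterOp_wordVec]
    exact wordVec_mem_wordFilt (by simpa using hw)
  | zero => simp
  | add x y _ _ hx hy => rw [map_add]; exact Submodule.add_mem _ hx hy
  | smul c x _ hx => rw [map_smul]; exact Submodule.smul_mem _ _ hx

theorem wordDegree_sub_mem {n : ℕ} {v : WordSpace s} (hv : v ∈ wordFilt s n) :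
    wordDegree s v - (n : ℝ) • v ∈ wordFilt s (n + 1) := by
  induction hv using Submodule.span_induction with
  | mem x h =>
    obtain ⟨w, hw, rfl⟩ := h
    rw [wordDegree_wordVec, ← sub_smul]
    rcases hw.eq_or_lt with h | h
    · simp [h]
    · exact Submodule.smul_mem _ _ (wordVec_mem_wordFilt h)
  | zero => simp
  | add x y _ _ hx hy =>
    rw [map_add, smul_add, add_sub_add_comm]; exact Submodule.add_mem _ hx hy
  | smul c x _ hx =>
    rw [map_smul, smul_comm, ← smul_sub]; exact Submodule.smul_mem _ _ hx

theorem wordDegree_commutator_sub_mem {n : ℕ} {f : Module.End ℝ (WordSpace s)}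
    (hf : f ∈ (wordEndFilt s).term n) :
    wordDegree s * f - f * wordDegree s - (n : ℝ) • f ∈ (wordEndFilt s).term (n + 1) := by
  intro j v hv
  have h1 := wordDegree_sub_mem (hf j v hv)
  have h2 := hf _ _ (wordDegree_sub_mem hv)
  have h3 : (wordDegree s * f - f * wordDegree s - (n : ℝ) • f) v =
      (wordDegree s (f v) - ((j + n : ℕ) : ℝ) • f v) - f (wordDegree s v - (j : ℝ) • v) := by
    simp only [LinearMap.sub_apply, Module.End.mul_apply, LinearMap.smul_apply, map_sub, map_smul]
    push_cast
    module
  rw [h3]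
  rw [show j + 1 + n = j + (n + 1) by omega] at h2
  exact Submodule.sub_mem _ h1 h2

theorem wordDegree_commutator_letterOp (i : Bool) :
    wordDegree s * letterOp s i - letterOp s i * wordDegree s = letterOp s i := by
  refine wordSpace_hom_ext fun w _ => ?_
  rw [LinearMap.sub_apply, Module.End.mul_apply, Module.End.mul_apply,
    wordDegree_wordVec, map_smul, letterOp_wordVec, wordDegree_wordVec, ← sub_smul]
  simp

variable (s) in
/-- The Lie polynomials in the letters, acting by left multiplication. -/
def liePoly : Submodule ℝ (Module.End ℝ (WordSpace s)) :=
  bracketSpan (letterOp s) 0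

variable (s) in
/-- The iterated bracket of the letters of a word, acting by left multiplication. -/
def lieWord (l : List Bool) : Module.End ℝ (WordSpace s) :=
  nestedBr (l.map (letterOp s))

theorem lieWord_singleton (i : Bool) : lieWord s [i] = letterOp s i := rfl

theorem lieWord_cons (i : Bool) {l : List Bool} (hl : l ≠ []) :
    lieWord s (i :: l) = letterOp s i * lieWord s l - lieWord s l * letterOp s i :=
  nestedBr_cons_eq_sub (letterOp s i) (by simpa using hl)

theorem letterOp_mem_liePoly (i : Bool) : letterOp s i ∈ liePoly s :=
  nestedBr_mem_bracketSpan (letterOp s) [i] (Nat.zero_le _)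

/-- An element of `liePoly` whose exponential is the product of those of the letters. -/
theorem mem_liePoly_of_truncExp_eq_mul {Z : Module.End ℝ (WordSpace s)}
    (hZ : Z ∈ (wordEndFilt s).term 1) {i j : Bool}
    (h : truncExp s Z = truncExp s (letterOp s i) * truncExp s (letterOp s j)) :
    Z ∈ liePoly s := by
  refine (wordEndFilt s).mem_of_truncExp_eq_mul (wordDegree s)
    (fun n w => wordDegree_commutator_sub_mem) (liePoly s) ?_
    (fun x hx y hy => commutator_mem_bracketSpan (letterOp s) hx hy)
    (fun x hx => degree_commutator_mem_bracketSpan _ wordDegree_commutator_letterOp hx)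
    (letterOp_mem_liePoly i) (letterOp_mem_liePoly j) hZ h
  rw [liePoly, bracketSpan, Submodule.span_le]
  rintro _ ⟨l, -, rfl⟩
  exact (wordEndFilt s).nestedBr_mem _ letterOp_mem l

theorem letterOp_pow_wordVec (i : Bool) (k : ℕ) (w : List Bool) :
    (letterOp s i ^ k) (wordVec s w) = wordVec s (List.replicate k i ++ w) := by
  induction k with
  | zero => simp
  | succ k ih =>
    rw [pow_succ', Module.End.mul_apply, ih, letterOp_wordVec, List.replicate_succ,
      List.cons_append]

theorem truncExp_letterOp_wordVec (i : Bool) (w : List Bool) :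
    truncExp s (letterOp s i) (wordVec s w) =
      ∑ k : Fin (s + 1), (((k : ℕ).factorial : ℝ)⁻¹) •
        wordVec s (List.replicate (k : ℕ) i ++ w) := by
  rw [truncExp, Finset.sum_range, LinearMap.sum_apply]
  simp only [LinearMap.smul_apply, letterOp_pow_wordVec]

variable (s) in
/-- The coefficient of `a ^ k * b ^ l` in `exp a * exp b - 1`. -/
def expCoeff (kl : Fin (s + 1) × Fin (s + 1)) : ℝ :=
  if 1 ≤ (kl.1 : ℕ) + (kl.2 : ℕ) then
    (((kl.1 : ℕ).factorial * (kl.2 : ℕ).factorial : ℕ) : ℝ)⁻¹ else 0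

variable (s) in
/-- The word `a ^ k * b ^ l`. -/
def expWord (kl : Fin (s + 1) × Fin (s + 1)) : List Bool :=
  List.replicate (kl.1 : ℕ) true ++ List.replicate (kl.2 : ℕ) false

theorem truncExp_mul_sub_one_wordVec (w : List Bool) :
    (truncExp s (letterOp s true) * truncExp s (letterOp s false) - 1) (wordVec s w) =
      ∑ kl, expCoeff s kl • wordVec s (expWord s kl ++ w) := by
  have h : ∀ kl : Fin (s + 1) × Fin (s + 1),
      (((kl.1 : ℕ).factorial * (kl.2 : ℕ).factorial : ℕ) : ℝ)⁻¹ • wordVec s (expWord s kl ++ w) =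
        expCoeff s kl • wordVec s (expWord s kl ++ w) + if kl = 0 then wordVec s w else 0 := by
    intro kl
    by_cases hkl : kl = 0
    · subst hkl
      simp [expCoeff, expWord]
    · have : 1 ≤ (kl.1 : ℕ) + (kl.2 : ℕ) := by
        by_contra! hlt
        exact hkl (Prod.ext (Fin.ext (by rw [Prod.fst_zero, Fin.val_zero]; omega))
          (Fin.ext (by rw [Prod.snd_zero, Fin.val_zero]; omega)))
      rw [expCoeff, if_pos this, if_neg hkl, add_zero]
  rw [LinearMap.sub_apply, Module.End.mul_apply, Module.End.one_apply, truncExp_letterOp_wordVec,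
    map_sum, sub_eq_iff_eq_add]
  simp only [map_smul, truncExp_letterOp_wordVec, Finset.smul_sum]
  rw [Finset.sum_comm, ← Fintype.sum_prod_type']
  rw [← Fintype.sum_ite_eq (0 : Fin (s + 1) × Fin (s + 1)) fun _ => wordVec s w,
    ← Finset.sum_add_distrib]
  refine Finset.sum_congr rfl fun kl _ => ?_
  simp only [eq_comm (a := (0 : Fin (s + 1) × Fin (s + 1)))]
  rw [← h, smul_smul, expWord, List.append_assoc]
  congr 1
  push_cast
  rw [mul_inv, mul_comm]

theorem pow_wordVec {ι : Type*} [Fintype ι] {f : Module.End ℝ (WordSpace s)} {a : ι → ℝ}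
    {b : ι → List Bool} (hf : ∀ w, f (wordVec s w) = ∑ i, a i • wordVec s (b i ++ w)) (p : ℕ)
    (w : List Bool) : (f ^ p) (wordVec s w) =
      ∑ k : Fin p → ι, (∏ j, a (k j)) • wordVec s ((List.ofFn fun j => b (k j)).flatten ++ w) := by
  induction p with
  | zero => simp
  | succ p ih =>
    rw [pow_succ', Module.End.mul_apply, ih, map_sum]
    simp only [map_smul, hf, Finset.smul_sum]
    rw [Finset.sum_comm, ← Fintype.sum_prod_type', ← (Fin.consEquiv fun _ => ι).sum_comp]
    refine Finset.sum_congr rfl fun k _ => ?_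
    simp [Fin.consEquiv, Fin.prod_univ_succ, smul_smul, mul_comm, List.ofFn_succ]

section Eval

variable {A : Type*} [Ring A] [Algebra ℝ A]

/-- The pairs of an endomorphism and an algebra element intertwined by a linear map. -/
def intertwiner {V : Type*} [AddCommGroup V] [Module ℝ V] (ψ : V →ₗ[ℝ] A) :
    Subalgebra ℝ (Module.End ℝ V × A) where
  carrier := {p | ∀ v, ψ (p.1 v) = p.2 * ψ v}
  mul_mem' := fun {p q} hp hq v => by
    rw [Prod.fst_mul, Module.End.mul_apply, hp, hq, Prod.snd_mul, mul_assoc]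
  add_mem' := fun {p q} hp hq v => by
    rw [Prod.fst_add, LinearMap.add_apply, map_add, hp, hq, Prod.snd_add, add_mul]
  algebraMap_mem' := fun c v => by
    rw [Prod.algebraMap_apply, Module.algebraMap_end_apply, map_smul, Algebra.smul_def]

theorem commutator_mem_intertwiner {V : Type*} [AddCommGroup V] [Module ℝ V] {ψ : V →ₗ[ℝ] A}
    {f f' : Module.End ℝ V} {x x' : A} (h : (f, x) ∈ intertwiner ψ)
    (h' : (f', x') ∈ intertwiner ψ) :
    (f * f' - f' * f, x * x' - x' * x) ∈ intertwiner ψ :=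
  Subalgebra.sub_mem _ (Subalgebra.mul_mem _ h h') (Subalgebra.mul_mem _ h' h)

theorem truncExp_mem (S : Subalgebra ℝ A) {x : A} (hx : x ∈ S) : truncExp s x ∈ S :=
  Subalgebra.sum_mem _ fun _ _ => Subalgebra.smul_mem _ (Subalgebra.pow_mem _ hx _) _

theorem truncLog_mem (S : Subalgebra ℝ A) {x : A} (hx : x ∈ S) : truncLog s x ∈ S :=
  Subalgebra.sum_mem _ fun _ _ =>
    Subalgebra.smul_mem _
      (Subalgebra.pow_mem _ (Subalgebra.sub_mem _ hx (Subalgebra.one_mem _)) _) _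

theorem truncLog_mem_intertwiner {V : Type*} [AddCommGroup V] [Module ℝ V] {ψ : V →ₗ[ℝ] A}
    {f f' : Module.End ℝ V} {x x' : A} (h : (f, x) ∈ intertwiner ψ)
    (h' : (f', x') ∈ intertwiner ψ) :
    (truncLog s (truncExp s f * truncExp s f'), truncLog s (truncExp s x * truncExp s x')) ∈
      intertwiner ψ := by
  have hmem : truncLog s (truncExp s (f, x) * truncExp s (f', x')) ∈ intertwiner ψ :=
    truncLog_mem _ (Subalgebra.mul_mem _ (truncExp_mem _ h) (truncExp_mem _ h'))
  have hfst := map_truncLog (s := s) (AlgHom.fst ℝ (Module.End ℝ V) A)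
    (truncExp s (f, x) * truncExp s (f', x'))
  have hsnd := map_truncLog (s := s) (AlgHom.snd ℝ (Module.End ℝ V) A)
    (truncExp s (f, x) * truncExp s (f', x'))
  rw [map_mul, map_truncExp, map_truncExp] at hfst hsnd
  convert hmem using 1
  exact (Prod.ext hfst hsnd).symm

variable (T : NilpotentFiltration A s) {g : Bool → A}

theorem NilpotentFiltration.truncExp_mul_sub_one_mem {x y : A} (hx : x ∈ T.term 1)
    (hy : y ∈ T.term 1) : truncExp s x * truncExp s y - 1 ∈ T.term 1 := by
  have h1 := T.truncExp_sub_one_mem le_rfl hx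
  have h2 := T.truncExp_sub_one_mem le_rfl hy
  have h3 := Submodule.add_mem _ (T.mul_mem_of_le h1 h2 (Nat.le_add_left 1 1))
    (Submodule.add_mem _ h1 h2)
  convert h3 using 1
  noncomm_ring

theorem NilpotentFiltration.prod_mem (hg : ∀ i, g i ∈ T.term 1) (w : List Bool) :
    (w.map g).prod ∈ T.term w.length := by
  induction w with
  | nil => exact T.one_mem
  | cons i w ih =>
    rw [List.map_cons, List.prod_cons]
    exact T.mul_mem_of_le (hg i) ih (by rw [List.length_cons]; omega)

variable (s g) in
/-- Evaluation of words in an algebra. -/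
def wordEval : WordSpace s →ₗ[ℝ] A := wordLift fun w => (w.map g).prod

theorem wordEval_nil : wordEval s g (wordVec s []) = 1 := by
  simp [wordEval, wordLift_wordVec]

theorem letterOp_mem_intertwiner (hg : ∀ i, g i ∈ T.term 1) (i : Bool) :
    (letterOp s i, g i) ∈ intertwiner (wordEval s g) := by
  have h : (wordEval s g).comp (letterOp s i) =
      (LinearMap.mulLeft ℝ (g i)).comp (wordEval s g) := by
    refine wordSpace_hom_ext fun w hw => ?_
    rw [LinearMap.comp_apply, LinearMap.comp_apply, letterOp_wordVec, wordEval, wordLift_wordVec,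
      wordLift_wordVec, if_pos hw, LinearMap.mulLeft_apply, List.map_cons, List.prod_cons]
    split_ifs with h
    · rfl
    · exact (T.eq_zero (T.prod_mem hg (i :: w)) (not_le.1 h)).symm
  exact fun v => LinearMap.congr_fun h v

end Eval

theorem lieWord_apply_mem (l : List Bool) (v : WordSpace s) : lieWord s l v ∈ wordFilt s 1 := by
  have := (wordEndFilt s).nestedBr_mem _ letterOp_mem l 0 v (by rw [wordFilt_zero]; trivial)
  rwa [zero_add] at this

theorem wordDegree_lieWord_nil (l : List Bool) :
    wordDegree s (lieWord s l (wordVec s [])) = (l.length : ℝ) • lieWord s l (wordVec s []) := by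
  have h : wordDegree s * lieWord s l - lieWord s l * wordDegree s =
      (l.length : ℝ) • lieWord s l :=
    commutator_nestedBr (letterOp s) wordDegree_commutator_letterOp l
  have h' := LinearMap.congr_fun h (wordVec s [])
  rwa [LinearMap.sub_apply, Module.End.mul_apply, Module.End.mul_apply, wordDegree_wordVec,
    List.length_nil, Nat.cast_zero, zero_smul, map_zero, sub_zero] at h'

section Bracketing

variable {F : Type*} [LieRing F] [LieAlgebra ℝ F]
  (hF : ∀ l : List F, s < l.length → nestedBr l = 0) (c : Bool → F)

variable (s) in
/-- The linear map sending a word to the iterated bracket of its letters. -/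
def wordBr : WordSpace s →ₗ[ℝ] F := wordLift fun w => nestedBr (w.map c)

variable (s) in
/-- The linear map sending a word to the iterated bracket of its letters divided by its length. -/
def wordBrDiv : WordSpace s →ₗ[ℝ] F :=
  wordLift fun w => ((w.length : ℝ)⁻¹) • nestedBr (w.map c)

include hF

theorem wordBr_wordVec (w : List Bool) : wordBr s c (wordVec s w) = nestedBr (w.map c) := by
  rw [wordBr, wordLift_wordVec]
  split_ifs with h
  · rfl
  · exact (hF _ (by simpa using h)).symm

theorem wordBr_letterOp (i : Bool) {v : WordSpace s} (hv : v ∈ wordFilt s 1) :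
    wordBr s c (letterOp s i v) = ⁅c i, wordBr s c v⁆ := by
  induction hv using Submodule.span_induction with
  | mem x h =>
    obtain ⟨w, hw, rfl⟩ := h
    rw [letterOp_wordVec, wordBr_wordVec hF, wordBr_wordVec hF, List.map_cons, nestedBr_cons]
    rintro h
    simp_all
  | zero => simp
  | add x y _ _ hx hy => simp only [map_add, lie_add, hx, hy]
  | smul r x _ hx => simp only [map_smul, lie_smul, hx]

theorem wordBr_lieWord (l : List Bool) {v : WordSpace s} (hv : v ∈ wordFilt s 1) :
    wordBr s c (lieWord s l v) = ⁅nestedBr (l.map c), wordBr s c v⁆ := by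
  induction l generalizing v with
  | nil => simp [lieWord, nestedBr]
  | cons i l ih =>
    rcases eq_or_ne l [] with rfl | hne
    · exact wordBr_letterOp hF c i hv
    · have h1 : letterOp s i v ∈ wordFilt s 1 := wordFilt_anti (by omega) (letterOp_mem i 1 v hv)
      rw [lieWord_cons i hne, LinearMap.sub_apply, Module.End.mul_apply, Module.End.mul_apply,
        map_sub, wordBr_letterOp hF c i (lieWord_apply_mem l v), ih hv, ih h1,
        wordBr_letterOp hF c i hv, List.map_cons, nestedBr_cons _ (by simpa using hne), lie_lie]

/-- The Dynkin-Specht-Wever theorem. -/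
theorem wordBr_lieWord_nil (l : List Bool) :
    wordBr s c (lieWord s l (wordVec s [])) = (l.length : ℝ) • nestedBr (l.map c) := by
  induction l with
  | nil => simp [lieWord, nestedBr]
  | cons i l ih =>
    rcases eq_or_ne l [] with rfl | hne
    · rw [lieWord_singleton, letterOp_wordVec, wordBr_wordVec hF]
      simp
    · have h1 : wordVec s [i] ∈ wordFilt s 1 := wordVec_mem_wordFilt (by simp)
      rw [lieWord_cons i hne, LinearMap.sub_apply, Module.End.mul_apply, Module.End.mul_apply,
        map_sub, wordBr_letterOp hF c i (lieWord_apply_mem l _), ih, letterOp_wordVec,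
        wordBr_lieWord hF c l h1, wordBr_wordVec hF, show nestedBr ([i].map c) = c i from rfl,
        List.map_cons, nestedBr_cons _ (by simpa using hne), lie_smul,
        ← lie_skew (nestedBr (l.map c)), List.length_cons]
      push_cast
      module

omit hF in
theorem wordBrDiv_wordDegree (v : WordSpace s) : wordBrDiv s c (wordDegree s v) = wordBr s c v := by
  refine LinearMap.congr_fun (f := (wordBrDiv s c).comp (wordDegree s)) ?_ v
  refine wordSpace_hom_ext fun w hw => ?_
  rw [LinearMap.comp_apply, wordDegree_wordVec, map_smul, wordBrDiv, wordBr, wordLift_wordVec,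
    wordLift_wordVec, if_pos hw, if_pos hw]
  rcases eq_or_ne w [] with rfl | h
  · simp [nestedBr]
  · rw [smul_inv_smul₀]
    simpa using h

theorem wordBrDiv_lieWord_nil (l : List Bool) :
    wordBrDiv s c (lieWord s l (wordVec s [])) = nestedBr (l.map c) := by
  rcases eq_or_ne l [] with rfl | hne
  · simp [lieWord, nestedBr]
  have h2 := wordBr_lieWord_nil hF c l
  rw [← wordBrDiv_wordDegree, wordDegree_lieWord_nil, map_smul] at h2
  exact smul_right_injective F (r := (l.length : ℝ)) (by simpa using hne) h2

omit hF in
theorem expCoeff_prod {p : ℕ} (kl : Fin p → Fin (s + 1) × Fin (s + 1)) :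
    ∏ j, expCoeff s (kl j) = if ∀ j, 1 ≤ ((kl j).1 : ℕ) + ((kl j).2 : ℕ) then
      ((∏ j, (((kl j).1 : ℕ).factorial * ((kl j).2 : ℕ).factorial) : ℕ) : ℝ)⁻¹ else 0 := by
  simp only [expCoeff, Finset.prod_ite_zero, Finset.mem_univ, true_imp_iff]
  push_cast
  rw [Finset.prod_inv_distrib]

omit hF in
theorem wordBrDiv_truncLog_nil :
    wordBrDiv s c (truncLog s (truncExp s (letterOp s true) * truncExp s (letterOp s false))
      (wordVec s [])) = bch s (c true) (c false) := by
  rw [truncLog, LinearMap.sum_apply, map_sum, bch]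
  refine Finset.sum_congr rfl fun p _ => ?_
  rw [LinearMap.smul_apply, map_smul, pow_wordVec truncExp_mul_sub_one_wordVec, map_sum]
  congr 1
  refine Finset.sum_congr rfl fun kl _ => ?_
  have hlen : (List.ofFn fun j => expWord s (kl j)).flatten.length =
      ∑ j, (((kl j).1 : ℕ) + ((kl j).2 : ℕ)) := by
    simp [List.length_flatten, List.map_ofFn, List.sum_ofFn, expWord]
  have hmap : (List.ofFn fun j => expWord s (kl j)).flatten.map c =
      (List.ofFn fun j => List.replicate ((kl j).1 : ℕ) (c true) ++
        List.replicate ((kl j).2 : ℕ) (c false)).flatten := by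
    simp [List.map_flatten, List.map_ofFn, expWord, Function.comp_def]
  rw [map_smul, List.append_nil, wordBrDiv, wordLift_wordVec, hlen, hmap, expCoeff_prod]
  by_cases h1 : ∀ j, 1 ≤ ((kl j).1 : ℕ) + ((kl j).2 : ℕ)
  · by_cases h2 : ∑ j, (((kl j).1 : ℕ) + ((kl j).2 : ℕ)) ≤ s
    · rw [if_pos h1, if_pos h2, if_pos ⟨h1, h2⟩, smul_smul, Nat.cast_mul, mul_inv]
    · rw [if_neg h2, if_neg fun h : _ ∧ _ => h2 h.2, smul_zero]
  · rw [if_neg h1, if_neg fun h : _ ∧ _ => h1 h.1, zero_smul]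

variable {A : Type*} [Ring A] [Algebra ℝ A]

omit hF in
theorem lieWord_mem_intertwiner (T : NilpotentFiltration A s) (σ : F →ₗ[ℝ] A)
    (hσT : ∀ x, σ x ∈ T.term 1) (hσ : ∀ x y, σ ⁅x, y⁆ = σ x * σ y - σ y * σ x) (l : List Bool) :
    (lieWord s l, σ (nestedBr (l.map c))) ∈ intertwiner (wordEval s fun i => σ (c i)) := by
  have hop := letterOp_mem_intertwiner T fun i => hσT (c i)
  induction l with
  | nil => exact fun v => by simp [lieWord, nestedBr]
  | cons i l ih =>
    rcases eq_or_ne l [] with rfl | hne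
    · exact hop i
    · rw [lieWord_cons i hne, List.map_cons, nestedBr_cons _ (by simpa using hne), hσ]
      exact commutator_mem_intertwiner (hop i) ih

theorem wordEval_liePoly (T : NilpotentFiltration A s) (σ : F →ₗ[ℝ] A)
    (hσT : ∀ x, σ x ∈ T.term 1) (hσ : ∀ x y, σ ⁅x, y⁆ = σ x * σ y - σ y * σ x)
    {Z : Module.End ℝ (WordSpace s)} (hZ : Z ∈ liePoly s) :
    wordEval s (fun i => σ (c i)) (Z (wordVec s [])) = σ (wordBrDiv s c (Z (wordVec s []))) := by
  induction hZ using Submodule.span_induction with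
  | mem x h =>
    obtain ⟨l, -, rfl⟩ := h
    have h1 := lieWord_mem_intertwiner c T σ hσT hσ l (wordVec s [])
    rw [wordEval_nil, mul_one] at h1
    exact h1.trans (congrArg σ (wordBrDiv_lieWord_nil hF c l).symm)
  | zero => simp
  | add x y _ _ hx hy => simp only [LinearMap.add_apply, map_add, hx, hy]
  | smul r x _ hx => simp only [LinearMap.smul_apply, map_smul, hx]

/-- The Baker-Campbell-Hausdorff formula: a representation `σ` of a nilpotent Lie algebra in an
algebra with a nilpotent filtration turns the truncated product into a product of exponentials. -/
theorem truncExp_bch (T : NilpotentFiltration A s) (σ : F →ₗ[ℝ] A) (hσT : ∀ x, σ x ∈ T.term 1)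
    (hσ : ∀ x y, σ ⁅x, y⁆ = σ x * σ y - σ y * σ x) (a b : F) :
    truncExp s (σ (bch s a b)) = truncExp s (σ a) * truncExp s (σ b) := by
  set c : Bool → F := fun i => cond i a b
  have hop := letterOp_mem_intertwiner T fun i => hσT (c i)
  have hGT := (wordEndFilt s).truncExp_mul_sub_one_mem (letterOp_mem true) (letterOp_mem false)
  have hZ := mem_liePoly_of_truncExp_eq_mul ((wordEndFilt s).truncLog_mem hGT)
    (truncExp_truncLog ((wordEndFilt s).pow_eq_zero hGT (Nat.lt_succ_self s)))
  have hpair := truncLog_mem_intertwiner (s := s) (hop true) (hop false) (wordVec s [])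
  rw [wordEval_nil, mul_one, wordEval_liePoly hF c T σ hσT hσ hZ, wordBrDiv_truncLog_nil] at hpair
  change σ (bch s a b) = _ at hpair
  rw [hpair]
  exact truncExp_truncLog
    (T.pow_eq_zero (T.truncExp_mul_sub_one_mem (hσT a) (hσT b)) (Nat.lt_succ_self s))

end Bracketing

end Words

end Associative

namespace NilpotentFiltration

variable {A : Type*} [Ring A] [Algebra ℝ A] {s : ℕ} (T : NilpotentFiltration A s)

theorem sub_mem_of_truncExp_sub_mem {x y : A} (hx : x ∈ T.term 1) (hy : y ∈ T.term 1) {n : ℕ}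
    (h : truncExp s y - truncExp s x ∈ T.term n) : y - x ∈ T.term n := by
  induction n with
  | zero => exact T.anti (Nat.zero_le 1) (Submodule.sub_mem _ hy hx)
  | succ n ih =>
    rcases Nat.eq_zero_or_pos n with rfl | hn
    · exact Submodule.sub_mem _ hy hx
    · have h1 := T.truncExp_add_sub_mem hn hx (ih (T.anti (Nat.le_succ n) h))
      rw [add_sub_cancel] at h1
      simpa using Submodule.sub_mem _ h h1

theorem eq_of_truncExp_eq {x y : A} (hx : x ∈ T.term 1) (hy : y ∈ T.term 1)
    (h : truncExp s x = truncExp s y) : x = y :=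
  sub_eq_zero.1 <| T.eq_zero (T.sub_mem_of_truncExp_sub_mem (n := s + 1) hy hx (by simp [h]))
    (Nat.lt_succ_self s)

theorem sub_mem_of_truncExp_sub_one_sub_mem {x w : A} {n : ℕ} (hn : 1 ≤ n) (hx : x ∈ T.term 1)
    (hw : w ∈ T.term n) (h : truncExp s x - 1 - w ∈ T.term (n + 1)) : x - w ∈ T.term (n + 1) := by
  refine T.sub_mem_of_truncExp_sub_mem (T.anti hn hw) hx ?_
  have h1 := T.anti (by omega : n + 1 ≤ 2 * n) (T.truncExp_sub_sub_mem hn hw)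
  convert Submodule.sub_mem _ h h1 using 1
  abel

theorem truncExp_mul_sub_mem {u v : A} {n : ℕ} (hn : 1 ≤ n) (hu : u ∈ T.term n)
    (hv : v ∈ T.term n) : truncExp s u * truncExp s v - 1 - (u + v) ∈ T.term (n + 1) := by
  have h1 := T.mul_mem_of_le (T.truncExp_sub_one_mem hn hu) (T.truncExp_sub_one_mem hn hv)
    (by omega : n + 1 ≤ n + n)
  have h2 := T.anti (by omega : n + 1 ≤ 2 * n) (T.truncExp_sub_sub_mem hn hu)
  have h3 := T.anti (by omega : n + 1 ≤ 2 * n) (T.truncExp_sub_sub_mem hn hv)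
  convert Submodule.add_mem _ h1 (Submodule.add_mem _ h2 h3) using 1
  noncomm_ring

theorem truncExp_commutator_sub_mem {u v : A} {m n : ℕ} (hm : 1 ≤ m) (hn : 1 ≤ n)
    (hu : u ∈ T.term m) (hv : v ∈ T.term n) :
    truncExp s u * truncExp s v * truncExp s (-u) * truncExp s (-v) - 1 - (u * v - v * u) ∈
      T.term (m + n + 1) := by
  have hu' := truncExp_mul_truncExp_neg (T.pow_eq_zero (T.anti hm hu) (Nat.lt_succ_self s))
  have hv' := truncExp_mul_truncExp_neg (T.pow_eq_zero (T.anti hn hv) (Nat.lt_succ_self s))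
  have hα := T.anti (by omega : m + 1 ≤ 2 * m) (T.truncExp_sub_sub_mem hm hu)
  have hβ := T.anti (by omega : n + 1 ≤ 2 * n) (T.truncExp_sub_sub_mem hn hv)
  have hg := T.truncExp_sub_one_mem hm hu
  have hh := T.truncExp_sub_one_mem hn hv
  have hgh := T.truncExp_mul_sub_one_mem (Submodule.neg_mem _ (T.anti hm hu))
    (Submodule.neg_mem _ (T.anti hn hv))
  set g := truncExp s u
  set h := truncExp s v
  set g' := truncExp s (-u)
  set h' := truncExp s (-v)
  have hκ := Submodule.sub_mem _ (T.mul_mem_of_le hg hh le_rfl)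
    (T.mul_mem_of_le hh hg (add_comm m n).le)
  have h1 := T.mul_mem_of_le hκ hgh le_rfl
  have h2 := T.mul_mem_of_le hα hh (by omega : m + n + 1 ≤ _)
  have h3 := T.mul_mem_of_le hu hβ (by omega : m + n + 1 ≤ _)
  have h4 := T.mul_mem_of_le hβ hg (by omega : m + n + 1 ≤ _)
  have h5 := T.mul_mem_of_le hv hα (by omega : m + n + 1 ≤ _)
  have key : g * h * g' * h' - 1 = ((g - 1) * (h - 1) - (h - 1) * (g - 1)) * (g' * h') := by
    have : ((g - 1) * (h - 1) - (h - 1) * (g - 1)) * (g' * h') =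
        g * h * g' * h' - h * (g * g') * h' := by noncomm_ring
    rw [this, hu', mul_one, hv']
  rw [key]
  convert Submodule.add_mem _ h1 (Submodule.sub_mem _ (Submodule.add_mem _ h2 h3)
    (Submodule.add_mem _ h4 h5)) using 1
  noncomm_ring

end NilpotentFiltration

section Generation

variable {F : Type*} [LieRing F] [LieAlgebra ℝ F] {ι : Type*} {s : ℕ}
  {A : Type*} [Ring A] [Algebra ℝ A]

variable (s) in
/-- The submonoid generated by the exponentials of the span of a family. -/
def expMonoid (W : ι → F) (σ : F →ₗ[ℝ] A) : Submonoid A :=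
  Submonoid.closure ((fun x => truncExp s (σ x)) '' (Submodule.span ℝ (range W) : Set F))

variable {W : ι → F} {σ : F →ₗ[ℝ] A}

theorem truncExp_mem_expMonoid {x : F} (hx : x ∈ Submodule.span ℝ (range W)) :
    truncExp s (σ x) ∈ expMonoid s W σ :=
  Submonoid.subset_closure ⟨x, hx, rfl⟩

theorem bracketSpan_eq_bot (hF : ∀ l : List F, s < l.length → nestedBr l = 0) :
    bracketSpan W (s + 1) = ⊥ := by
  rw [eq_bot_iff, bracketSpan, Submodule.span_le]
  rintro _ ⟨l, hl, rfl⟩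
  exact hF _ (by simpa using hl)

theorem exists_list_of_mem_expMonoid {m : A} (hm : m ∈ expMonoid s W σ) :
    ∃ l : List F, (∀ x ∈ l, x ∈ Submodule.span ℝ (range W)) ∧
      (l.map fun x => truncExp s (σ x)).prod = m := by
  induction hm using Submonoid.closure_induction with
  | mem m h =>
    obtain ⟨x, hx, rfl⟩ := h
    exact ⟨[x], by simpa using hx, by simp⟩
  | one => exact ⟨[], by simp, rfl⟩
  | mul m m' _ _ h h' =>
    obtain ⟨l, hl, rfl⟩ := h
    obtain ⟨l', hl', rfl⟩ := h'
    exact ⟨l ++ l', fun x hx => (List.mem_append.1 hx).elim (hl x) (hl' x), by simp⟩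

variable (T : NilpotentFiltration A s)
  (hT : ∀ n x, σ x ∈ T.term (n + 1) ↔ x ∈ bracketSpan W (n + 1))
  (htop : bracketSpan W 1 = ⊤)

include hT htop

theorem rep_mem_term_one (x : F) : σ x ∈ T.term 1 :=
  (hT 0 x).2 (by rw [zero_add, htop]; trivial)

theorem truncExp_rep_mul_neg (x : F) : truncExp s (σ x) * truncExp s (σ (-x)) = 1 := by
  rw [map_neg]
  exact truncExp_mul_truncExp_neg
    (T.pow_eq_zero (rep_mem_term_one T hT htop x) (Nat.lt_succ_self s))

theorem exists_mul_eq_one_of_mem_expMonoid {m : A} (hm : m ∈ expMonoid s W σ) :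
    ∃ m' ∈ expMonoid s W σ, m' * m = 1 := by
  induction hm using Submonoid.closure_induction with
  | mem m h =>
    obtain ⟨x, hx, rfl⟩ := h
    refine ⟨_, truncExp_mem_expMonoid (Submodule.neg_mem _ hx), ?_⟩
    simpa using truncExp_rep_mul_neg T hT htop (-x)
  | one => exact ⟨1, Submonoid.one_mem _, mul_one 1⟩
  | mul m n _ _ h h' =>
    obtain ⟨m', hm', hmm⟩ := h
    obtain ⟨n', hn', hnn⟩ := h'
    refine ⟨n' * m', Submonoid.mul_mem _ hn' hm', ?_⟩
    rw [mul_assoc, ← mul_assoc m', hmm, one_mul, hnn]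

theorem truncExp_neg_mem_expMonoid {x : F} (hx : truncExp s (σ x) ∈ expMonoid s W σ) :
    truncExp s (σ (-x)) ∈ expMonoid s W σ := by
  obtain ⟨m', hm', h⟩ := exists_mul_eq_one_of_mem_expMonoid T hT htop hx
  have h1 := congrArg (m' * ·) (truncExp_rep_mul_neg T hT htop x)
  simp only [← mul_assoc, h, one_mul, mul_one] at h1
  rwa [h1]

theorem sub_mem_bracketSpan_of_truncExp {x w : F} {n : ℕ} (hw : w ∈ bracketSpan W (n + 1))
    (h : truncExp s (σ x) - 1 - σ w ∈ T.term (n + 2)) : x - w ∈ bracketSpan W (n + 2) := by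
  rw [← hT, map_sub]
  exact T.sub_mem_of_truncExp_sub_one_sub_mem (Nat.le_add_left 1 n)
    (rep_mem_term_one T hT htop x) ((hT n w).2 hw) h

variable (hσ : ∀ x y, σ ⁅x, y⁆ = σ x * σ y - σ y * σ x)
  (hF : ∀ l : List F, s < l.length → nestedBr l = 0)

include hσ hF

theorem truncExp_rep_bch (x y : F) :
    truncExp s (σ (bch s x y)) = truncExp s (σ x) * truncExp s (σ y) :=
  truncExp_bch hF T σ (rep_mem_term_one T hT htop) hσ x y

theorem bch_sub_add_mem {x y : F} {n : ℕ} (hx : x ∈ bracketSpan W (n + 1))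
    (hy : y ∈ bracketSpan W (n + 1)) : bch s x y - (x + y) ∈ bracketSpan W (n + 2) := by
  refine sub_mem_bracketSpan_of_truncExp T hT htop (Submodule.add_mem _ hx hy) ?_
  rw [truncExp_rep_bch T hT htop hσ hF, map_add]
  exact T.truncExp_mul_sub_mem (Nat.le_add_left 1 n) ((hT n x).2 hx) ((hT n y).2 hy)

/-- Every iterated bracket is, to leading order, a group commutator of generators. -/
theorem exists_expMonoid_nestedBr (c : ℝ) {l : List ι} (hl : l ≠ []) :
    ∃ x, truncExp s (σ x) ∈ expMonoid s W σ ∧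
      x - c • nestedBr (l.map W) ∈ bracketSpan W (l.length + 1) := by
  induction l with
  | nil => exact absurd rfl hl
  | cons i l ih =>
    rcases eq_or_ne l [] with rfl | hne
    · refine ⟨c • W i, truncExp_mem_expMonoid
        (Submodule.smul_mem _ _ (Submodule.subset_span (mem_range_self i))), ?_⟩
      simp [nestedBr]
    · obtain ⟨y, hyM, hy⟩ := ih hne
      obtain ⟨n, hn⟩ : ∃ n, l.length = n + 1 :=
        Nat.exists_eq_succ_of_ne_zero (by simpa using hne)
      rw [hn] at hy
      have hyn : y ∈ bracketSpan W (n + 1) := by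
        have h1 := Submodule.add_mem _ (bracketSpan_anti W (Nat.le_succ _) hy)
          (Submodule.smul_mem _ c (nestedBr_mem_bracketSpan W l hn.ge))
        rwa [sub_add_cancel] at h1
      have hWM : truncExp s (σ (W i)) ∈ expMonoid s W σ :=
        truncExp_mem_expMonoid (Submodule.subset_span (mem_range_self i))
      have hW : W i ∈ bracketSpan W (0 + 1) := by rw [zero_add, htop]; trivial
      have hbr : truncExp s (σ (bch s (bch s (bch s (W i) y) (-W i)) (-y))) =
          truncExp s (σ (W i)) * truncExp s (σ y) * truncExp s (σ (-W i)) *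
            truncExp s (σ (-y)) := by
        simp only [truncExp_rep_bch T hT htop hσ hF]
      refine ⟨bch s (bch s (bch s (W i) y) (-W i)) (-y), ?_, ?_⟩
      · rw [hbr]
        exact Submonoid.mul_mem _ (Submonoid.mul_mem _ (Submonoid.mul_mem _ hWM hyM)
          (truncExp_neg_mem_expMonoid T hT htop hWM)) (truncExp_neg_mem_expMonoid T hT htop hyM)
      · have h1 := lie_apply_mem_bracketSpan W i hy
        have h2 := sub_mem_bracketSpan_of_truncExp T hT htop
          (x := bch s (bch s (bch s (W i) y) (-W i)) (-y)) (lie_apply_mem_bracketSpan W i hyn) (by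
            have h3 := T.truncExp_commutator_sub_mem le_rfl (Nat.le_add_left 1 n)
              ((hT 0 _).2 hW) ((hT n y).2 hyn)
            rw [hbr, hσ, map_neg, map_neg]
            exact T.anti (by omega) h3)
        rw [List.length_cons, hn, List.map_cons, nestedBr_cons _ (by simpa using hne)]
        convert Submodule.add_mem _ h1 h2 using 1
        rw [lie_sub, lie_smul]
        abel

theorem exists_expMonoid_sub_mem {n : ℕ} {x : F} (hx : x ∈ bracketSpan W (n + 1)) (c : ℝ) :
    ∃ y, truncExp s (σ y) ∈ expMonoid s W σ ∧ c • x - y ∈ bracketSpan W (n + 2) := by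
  have hzero : truncExp s (σ 0) ∈ expMonoid s W σ := truncExp_mem_expMonoid (Submodule.zero_mem _)
  induction hx using Submodule.span_induction generalizing c with
  | mem x h =>
    obtain ⟨l, hl, rfl⟩ := h
    rcases hl.eq_or_lt with h | h
    · obtain ⟨y, hyM, hy⟩ := exists_expMonoid_nestedBr T hT htop hσ hF c (l := l)
        (by rintro rfl; simp at h)
      refine ⟨y, hyM, ?_⟩
      rw [← h] at hy
      rw [← neg_sub]
      exact Submodule.neg_mem _ hy
    · refine ⟨0, hzero, ?_⟩
      rw [sub_zero]
      exact Submodule.smul_mem _ _ (nestedBr_mem_bracketSpan W l h)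
  | zero => exact ⟨0, hzero, by simp⟩
  | add x x' hx hx' h h' =>
    obtain ⟨y, hyM, hy⟩ := h c
    obtain ⟨y', hyM', hy'⟩ := h' c
    have hmem : ∀ {u v : F}, u ∈ bracketSpan W (n + 1) → c • u - v ∈ bracketSpan W (n + 2) →
        v ∈ bracketSpan W (n + 1) := fun {u v} hu huv => by
      have := Submodule.sub_mem _ (Submodule.smul_mem _ c hu)
        (bracketSpan_anti W (Nat.le_succ _) huv)
      rwa [sub_sub_cancel] at this
    refine ⟨bch s y y', ?_, ?_⟩
    · rw [truncExp_rep_bch T hT htop hσ hF]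
      exact Submonoid.mul_mem _ hyM hyM'
    · convert Submodule.sub_mem _ (Submodule.add_mem _ hy hy')
        (bch_sub_add_mem T hT htop hσ hF (hmem hx hy) (hmem hx' hy')) using 1
      rw [smul_add]
      abel
  | smul d x _ h =>
    obtain ⟨y, hyM, hy⟩ := h (c * d)
    exact ⟨y, hyM, by rwa [smul_smul]⟩

theorem truncExp_rep_mem_expMonoid (k : ℕ) {n : ℕ} (hk : s ≤ n + k) {x : F}
    (hx : x ∈ bracketSpan W (n + 1)) : truncExp s (σ x) ∈ expMonoid s W σ := by
  induction k generalizing n x with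
  | zero =>
    rw [T.eq_zero ((hT n x).2 hx) (by omega), truncExp_zero]
    exact Submonoid.one_mem _
  | succ k ih =>
    obtain ⟨y, hyM, hy⟩ := exists_expMonoid_sub_mem T hT htop hσ hF hx 1
    rw [one_smul] at hy
    have hyn : -y ∈ bracketSpan W (n + 1) := by
      have := Submodule.sub_mem _ (bracketSpan_anti W (Nat.le_succ _) hy) hx
      rwa [sub_sub_cancel_left] at this
    have h1 : bch s (-y) x ∈ bracketSpan W (n + 1 + 1) := by
      convert Submodule.add_mem _ (bch_sub_add_mem T hT htop hσ hF hyn hx) hy using 1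
      abel
    have h2 := Submonoid.mul_mem _ hyM (ih (by omega) h1)
    rwa [truncExp_rep_bch T hT htop hσ hF, ← mul_assoc, truncExp_rep_mul_neg T hT htop,
      one_mul] at h2

theorem truncExp_rep_foldr_bch (l : List F) : truncExp s (σ (l.foldr (bch s) 0)) =
    (l.map fun x => truncExp s (σ x)).prod := by
  induction l with
  | nil => simp [truncExp_zero]
  | cons x l ih =>
    rw [List.foldr_cons, truncExp_rep_bch T hT htop hσ hF, ih, List.map_cons, List.prod_cons]

/-- A nilpotent Lie algebra with a representation detecting its lower central series is generated,
under the Baker-Campbell-Hausdorff product, by the span of its generators. -/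
theorem exists_eq_foldr_bch (x : F) : ∃ l : List F, l ≠ [] ∧
    (∀ y ∈ l, y ∈ Submodule.span ℝ (range W)) ∧ x = l.foldr (bch s) 0 := by
  have hx : truncExp s (σ x) ∈ expMonoid s W σ :=
    truncExp_rep_mem_expMonoid T hT htop hσ hF s (n := 0) (by omega)
      (by rw [zero_add, htop]; trivial)
  obtain ⟨l, hl, hprod⟩ := exists_list_of_mem_expMonoid hx
  refine ⟨0 :: l, by simp, by simpa using hl, ?_⟩
  have h := T.eq_of_truncExp_eq (rep_mem_term_one T hT htop x)
    (rep_mem_term_one T hT htop ((0 :: l).foldr (bch s) 0)) (by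
      rw [truncExp_rep_foldr_bch T hT htop hσ hF, List.map_cons, List.prod_cons, hprod, map_zero,
        truncExp_zero, one_mul])
  have h2 : x - (0 :: l).foldr (bch s) 0 ∈ bracketSpan W (s + 1) := by
    rw [← hT, map_sub, h, sub_self]
    exact Submodule.zero_mem _
  rwa [bracketSpan_eq_bot hF, Submodule.mem_bot, sub_eq_zero] at h2

end Generation

section Tangent

/-- The extension `L ⊗ ℝ[ε]` of a Lie algebra `L` by the dual numbers. -/
def TangentLie (L : Type) : Type := L × L

namespace TangentLie

variable {L : Type} [LieRing L] [LieAlgebra ℝ L]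

instance : AddCommGroup (TangentLie L) := inferInstanceAs (AddCommGroup (L × L))

instance : Module ℝ (TangentLie L) := inferInstanceAs (Module ℝ (L × L))

instance : LieRing (TangentLie L) where
  bracket x y := (⁅x.1, y.1⁆, ⁅x.1, y.2⁆ + ⁅x.2, y.1⁆)
  add_lie x y z := Prod.ext (add_lie x.1 y.1 z.1) <| by
    change ⁅x.1 + y.1, z.2⁆ + ⁅x.2 + y.2, z.1⁆ =
      ⁅x.1, z.2⁆ + ⁅x.2, z.1⁆ + (⁅y.1, z.2⁆ + ⁅y.2, z.1⁆)
    rw [add_lie, add_lie]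
    abel
  lie_add x y z := Prod.ext (lie_add x.1 y.1 z.1) <| by
    change ⁅x.1, y.2 + z.2⁆ + ⁅x.2, y.1 + z.1⁆ =
      ⁅x.1, y.2⁆ + ⁅x.2, y.1⁆ + (⁅x.1, z.2⁆ + ⁅x.2, z.1⁆)
    rw [lie_add, lie_add]
    abel
  lie_self x := Prod.ext (lie_self x.1) <| by
    change ⁅x.1, x.2⁆ + ⁅x.2, x.1⁆ = 0
    rw [← lie_skew x.1 x.2, neg_add_cancel]
  leibniz_lie x y z := Prod.ext (leibniz_lie x.1 y.1 z.1) <| by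
    change ⁅x.1, ⁅y.1, z.2⁆ + ⁅y.2, z.1⁆⁆ + ⁅x.2, ⁅y.1, z.1⁆⁆ =
      (⁅⁅x.1, y.1⁆, z.2⁆ + ⁅⁅x.1, y.2⁆ + ⁅x.2, y.1⁆, z.1⁆) +
        (⁅y.1, ⁅x.1, z.2⁆ + ⁅x.2, z.1⁆⁆ + ⁅y.2, ⁅x.1, z.1⁆⁆)
    simp only [lie_add, add_lie, lie_lie]
    abel

instance : LieAlgebra ℝ (TangentLie L) where
  lie_smul c x y := Prod.ext (lie_smul c x.1 y.1) <| by
    change ⁅x.1, c • y.2⁆ + ⁅x.2, c • y.1⁆ = c • (⁅x.1, y.2⁆ + ⁅x.2, y.1⁆)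
    rw [lie_smul, lie_smul, smul_add]

variable (L) in
/-- The reduction modulo `ε`. -/
def fst : TangentLie L →ₗ⁅ℝ⁆ L :=
  { LinearMap.fst ℝ L L with map_lie' := rfl }

variable (L) in
/-- The coefficient of `ε`. -/
def snd : TangentLie L →ₗ[ℝ] L := LinearMap.snd ℝ L L

theorem snd_lie (x y : TangentLie L) : snd L ⁅x, y⁆ = ⁅fst L x, snd L y⁆ + ⁅snd L x, fst L y⁆ := rfl

theorem ext {x y : TangentLie L} (h1 : fst L x = fst L y) (h2 : snd L x = snd L y) : x = y :=
  Prod.ext h1 h2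

theorem nestedBr_mem {ι : Type*} {W : ι → L} (htop : bracketSpan W 1 = ⊤)
    (l : List (TangentLie L)) : fst L (nestedBr l) ∈ bracketSpan W l.length ∧
      snd L (nestedBr l) ∈ bracketSpan W l.length := by
  have hmem : ∀ x, x ∈ bracketSpan W 1 := fun x => by rw [htop]; trivial
  induction l with
  | nil => exact ⟨Submodule.zero_mem _, Submodule.zero_mem _⟩
  | cons x l ih =>
    rcases eq_or_ne l [] with rfl | hne
    · exact ⟨hmem _, hmem _⟩
    · rw [nestedBr_cons x hne, snd_lie, LieHom.map_lie, List.length_cons, add_comm]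
      exact ⟨lie_mem_bracketSpan W (hmem _) ih.1, Submodule.add_mem _
        (lie_mem_bracketSpan W (hmem _) ih.2) (lie_mem_bracketSpan W (hmem _) ih.1)⟩

end TangentLie

end Tangent

section Free

variable {F : Type} [LieRing F] [LieAlgebra ℝ F] {r s : ℕ} {W : Fin r → F}

theorem IsFreeNilpotent.bracketSpan_one (h : IsFreeNilpotent r s W) : bracketSpan W 1 = ⊤ := by
  rw [← h.2.1, bracketSpan]
  simp only [Nat.one_le_iff_ne_zero, ne_eq, List.length_eq_zero_iff]

/-- A free nilpotent Lie algebra has a derivation fixing the generators. -/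
theorem IsFreeNilpotent.exists_derivation (h : IsFreeNilpotent r s W) :
    ∃ E : F →ₗ[ℝ] F, (∀ i, E (W i) = W i) ∧ ∀ x y, E ⁅x, y⁆ = ⁅x, E y⁆ + ⁅E x, y⁆ := by
  have hnil : ∀ l : List (TangentLie F), s < l.length → nestedBr l = 0 := by
    intro l hl
    have hmem := TangentLie.nestedBr_mem h.bracketSpan_one l
    have hbot : bracketSpan W l.length ≤ ⊥ :=
      (bracketSpan_anti W hl).trans (bracketSpan_eq_bot h.1).le
    exact TangentLie.ext ((Submodule.mem_bot ℝ).1 (hbot hmem.1))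
      ((Submodule.mem_bot ℝ).1 (hbot hmem.2))
  obtain ⟨f, hf, -⟩ := h.2.2 (TangentLie F) hnil fun i => (W i, W i)
  have hfst : ∀ x, TangentLie.fst F (f x) = x := by
    have := (h.2.2 F h.1 W).unique (y₁ := (TangentLie.fst F).comp f) (y₂ := LieHom.id)
      (fun i => by rw [LieHom.comp_apply, hf]; rfl) (fun i => rfl)
    exact fun x => LieHom.congr_fun this x
  refine ⟨TangentLie.snd F ∘ₗ (f : F →ₗ[ℝ] TangentLie F), fun i => ?_, fun x y => ?_⟩
  · rw [LinearMap.comp_apply, LieHom.coe_toLinearMap, hf]; rfl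
  · simp only [LinearMap.comp_apply, LieHom.coe_toLinearMap, LieHom.map_lie, TangentLie.snd_lie,
      hfst]

end Free

section Grading

variable {F : Type*} [LieRing F] [LieAlgebra ℝ F] {ι : Type*} {s : ℕ} {W : ι → F} {E : F →ₗ[ℝ] F}
  (hW : ∀ i, E (W i) = W i) (hE : ∀ x y, E ⁅x, y⁆ = ⁅x, E y⁆ + ⁅E x, y⁆)

include hW hE

theorem derivation_nestedBr (l : List ι) :
    E (nestedBr (l.map W)) = (l.length : ℝ) • nestedBr (l.map W) := by
  induction l with
  | nil => simp [nestedBr]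
  | cons i l ih =>
    rcases eq_or_ne l [] with rfl | hne
    · simpa [nestedBr] using hW i
    · rw [List.map_cons, nestedBr_cons _ (by simpa using hne), hE, ih, hW, lie_smul,
        List.length_cons]
      push_cast
      module

theorem derivation_sub_mem {n : ℕ} {x : F} (hx : x ∈ bracketSpan W n) :
    E x - (n : ℝ) • x ∈ bracketSpan W (n + 1) := by
  induction hx using Submodule.span_induction with
  | mem x h =>
    obtain ⟨l, hl, rfl⟩ := h
    rw [derivation_nestedBr hW hE, ← sub_smul]
    rcases hl.eq_or_lt with h | h
    · simp [h]
    · exact Submodule.smul_mem _ _ (nestedBr_mem_bracketSpan W l h)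
  | zero => simp
  | add x y _ _ hx hy =>
    rw [map_add, smul_add, add_sub_add_comm]; exact Submodule.add_mem _ hx hy
  | smul c x _ hx =>
    rw [map_smul, smul_comm, ← smul_sub]; exact Submodule.smul_mem _ _ hx

theorem derivation_mem_iff (htop : bracketSpan W 1 = ⊤) {n : ℕ} {x : F} :
    E x ∈ bracketSpan W n ↔ x ∈ bracketSpan W n := by
  constructor
  · intro h
    induction n with
    | zero => exact bracketSpan_anti W (Nat.zero_le 1) (by rw [htop]; trivial)
    | succ n ih =>
      rcases Nat.eq_zero_or_pos n with rfl | hn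
      · rw [zero_add, htop]; trivial
      · have h1 := derivation_sub_mem hW hE (ih (bracketSpan_anti W (Nat.le_succ n) h))
        have h2 := Submodule.sub_mem _ h h1
        rw [sub_sub_cancel] at h2
        exact (Submodule.smul_mem_iff _ (by exact_mod_cast hn.ne')).1 h2
  · intro h
    have h1 := Submodule.add_mem _ (bracketSpan_anti W (Nat.le_succ n) (derivation_sub_mem hW hE h))
      (Submodule.smul_mem _ (n : ℝ) h)
    rwa [sub_add_cancel] at h1

omit hW hE

variable (W) in
/-- The filtration of `F × ℝ` by `F × ℝ` and the lower central series of `F`. -/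
def extFilt : ℕ → Submodule ℝ (F × ℝ)
  | 0 => ⊤
  | n + 1 => (bracketSpan W (n + 1)).prod ⊥

theorem extFilt_anti : Antitone (extFilt W) := by
  refine antitone_nat_of_succ_le fun n => ?_
  cases n with
  | zero => exact le_top
  | succ n => exact Submodule.prod_mono (bracketSpan_anti W (Nat.le_succ _)) le_rfl

variable (E) in
/-- The adjoint representation of `F` on `F × ℝ`, extended by a derivation `E` of `F`. -/
def extAd : F →ₗ[ℝ] Module.End ℝ (F × ℝ) where
  toFun x := LinearMap.inl ℝ F ℝ ∘ₗ
    ((LieModule.toEnd ℝ F F x).coprod (LinearMap.toSpanSingleton ℝ F (E x)))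
  map_add' x y := LinearMap.ext fun v => Prod.ext (by simp; abel) (by simp)
  map_smul' c x := LinearMap.ext fun v => Prod.ext (by simp [smul_comm c]) (by simp)

theorem extAd_apply (x : F) (v : F × ℝ) : extAd E x v = (⁅x, v.1⁆ + v.2 • E x, 0) := by
  simp [extAd]

include hE in
theorem extAd_lie (x y : F) : extAd E ⁅x, y⁆ = extAd E x * extAd E y - extAd E y * extAd E x := by
  refine LinearMap.ext fun v => ?_
  rw [LinearMap.sub_apply, Module.End.mul_apply, Module.End.mul_apply]
  simp only [extAd_apply, hE, Prod.mk_sub_mk, lie_add, lie_smul, lie_lie, zero_smul, add_zero,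
    sub_zero, ← lie_skew (E x) y]
  congr 1
  module

include hW hE in
theorem extAd_mem_iff (hF : ∀ l : List F, s < l.length → nestedBr l = 0)
    (htop : bracketSpan W 1 = ⊤) (n : ℕ) (x : F) :
    extAd E x ∈ (endFiltration (s := s) (extFilt W) extFilt_anti rfl
      (by rw [extFilt, bracketSpan_eq_bot hF, Submodule.prod_bot])).term (n + 1) ↔
      x ∈ bracketSpan W (n + 1) := by
  constructor
  · intro h
    have h1 := (h 0 (0, 1) trivial).1
    rw [extAd_apply] at h1
    simpa [derivation_mem_iff hW hE htop] using h1
  · intro hx j v hv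
    rw [extAd_apply]
    cases j with
    | zero =>
      rw [zero_add]
      have hv1 : v.1 ∈ bracketSpan W 0 :=
        bracketSpan_anti W (Nat.zero_le 1) (by rw [htop]; trivial)
      have h1 : ⁅x, v.1⁆ ∈ bracketSpan W (n + 1) :=
        bracketSpan_anti W (by omega) (lie_mem_bracketSpan W hx hv1)
      have h2 : v.2 • E x ∈ bracketSpan W (n + 1) :=
        Submodule.smul_mem _ _ ((derivation_mem_iff hW hE htop).2 hx)
      exact ⟨Submodule.add_mem _ h1 h2, rfl⟩
    | succ j =>
      have hv2 : v.2 = 0 := hv.2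
      rw [hv2, zero_smul, add_zero]
      have hmem : ⁅x, v.1⁆ ∈ bracketSpan W (j + 1 + n + 1) :=
        bracketSpan_anti W (by omega) (lie_mem_bracketSpan W hx hv.1)
      exact ⟨hmem, rfl⟩

end Grading

/-- Proposition 4.1. The free Carnot group `(𝔣, ·)`, `A · B := P(A,B)`, is
generated by the first layer `𝔣₁ = span(W₁,…,W_r)`: every `A ∈ 𝔣` is a finite product
`A₁ · A₂ · ⋯ · A_k` of elements of `𝔣₁`. -/
theorem statement17 {F : Type} [LieRing F] [LieAlgebra ℝ F] (r s : ℕ) (hr : 2 ≤ r)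
    (hs : 1 ≤ s) (W : Fin r → F) (hfree : IsFreeNilpotent r s W) :
    ∀ A : F, ∃ l : List F, l ≠ [] ∧
      (∀ B ∈ l, B ∈ Submodule.span ℝ (Set.range W)) ∧
      A = l.foldr (bch s) 0 := by
  obtain ⟨E, hW, hE⟩ := hfree.exists_derivation
  exact exists_eq_foldr_bch _ (extAd_mem_iff hW hE hfree.1 hfree.bracketSpan_one)
    hfree.bracketSpan_one (extAd_lie hE) hfree.1
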